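/- For every integer k ≥ 0, real δ > -1, every n ≥ 1 and every index vector with 1 ≤ i_k < ⋯ < i_0, the expected degree counts m_n(i_0,…,i_k) := E[N_n(i_0,…,i_k)] satisfy the recursion m_n(i_0,…,i_k) = (1 − ((i_0−k)b_0+δ)/(τn+δ)) m_{n-1}(i_0,…,i_k) + ((i_k−1+δ)/(τn+δ)) m_{n-1}(i_0−1,…,i_k−1) + Σ_{m=0}^{k-1} (((i_m−k+m−1)b_m − (i_{m+1}−k+m+1)b_{m+1})/(τn+δ)) m_{n-1}(i_0−1,…,i_m−1,i_{m+1},…,i_k) + (k+1)·1{i_ℓ = k−ℓ+1 for all ℓ = 0,…,k}, where m_{n-1} of an index vector violating 1 ≤ i_k < ⋯ < i_0 is 0. -/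

import Mathlib

open MeasureTheory Filter Finset

noncomputable section

/-- The coefficient `b_m = k - m + 1 + δ(k - m)`. -/
def bcoef (k : ℕ) (δ : ℝ) (m : ℕ) : ℝ := (k : ℝ) - m + 1 + δ * ((k : ℝ) - m)

/-- The coefficient `τ = k + 2 + δ(k + 1)`. -/
def tauc (k : ℕ) (δ : ℝ) : ℝ := (k : ℝ) + 2 + δ * ((k : ℝ) + 1)

/-- A vector `(i_0, …, i_k)` of degrees is valid when `1 ≤ i_k < i_{k-1} < ⋯ < i_0`. -/
def ValidIdx (k : ℕ) (i : Fin (k + 1) → ℕ) : Prop :=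
  1 ≤ i (Fin.last k) ∧ StrictAnti i

/-- Decrease every coordinate of the index vector by one. -/
def allDec (k : ℕ) (i : Fin (k + 1) → ℕ) : Fin (k + 1) → ℕ := fun ℓ => i ℓ - 1

/-- Decrease the coordinates `0, …, m` of the index vector by one. -/
def decUpTo (k : ℕ) (m : ℕ) (i : Fin (k + 1) → ℕ) : Fin (k + 1) → ℕ :=
  fun ℓ => if (ℓ : ℕ) ≤ m then i ℓ - 1 else i ℓ

/-- The limiting degree recursion: `p` vanishes outside the valid index vectors, and on the
valid index vectors it satisfies the recursion of Theorem 2.1 of the paper. -/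
def LimitRecursion (k : ℕ) (δ : ℝ) (p : (Fin (k + 1) → ℕ) → ℝ) : Prop :=
  (∀ i, ¬ ValidIdx k i → p i = 0) ∧
  ∀ i, ValidIdx k i →
    p i = ((i (Fin.last k) : ℝ) - 1 + δ) / tauc k δ * p (allDec k i)
      + (∑ m : Fin k,
          (((i m.castSucc : ℝ) - 1 - k + (m : ℕ)) * bcoef k δ (m : ℕ)
            - ((i m.succ : ℝ) - k + (m : ℕ) + 1) * bcoef k δ ((m : ℕ) + 1)) / tauc k δ
            * p (decUpTo k (m : ℕ) i))
      - (((i 0 : ℝ) - k) * bcoef k δ 0 + δ) / tauc k δ * p i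
      + (if ∀ ℓ : Fin (k + 1), i ℓ = k - (ℓ : ℕ) + 1 then (1 : ℝ) else 0)

instance : MeasurableSpace (Finset ℕ) := ⊤
instance : MeasurableSpace (Finset (Finset ℕ)) := ⊤

/-- The `m`-degree of an `m`-simplex `s` in the simplicial complex `g`: the number of
`(m+1)`-simplices (i.e. sets of cardinality `m+2`) of `g` containing `s`. -/
def simDeg (m : ℕ) (g : Finset (Finset ℕ)) (s : Finset ℕ) : ℕ :=
  (g.filter fun t => s ⊆ t ∧ t.card = m + 2).card

/-- The initial complex: one `(k+1)`-simplex on the vertex set `{1, …, k+2}` together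
with all its (nonempty) subsimplices. -/
def initComplex (k : ℕ) : Finset (Finset ℕ) :=
  (Finset.Icc 1 (k + 2)).powerset.filter fun s => s.Nonempty

/-- Add to `g` the simplex `s ∪ {v}` together with all of its (nonempty) subsimplices. -/
def addSimplex (g : Finset (Finset ℕ)) (s : Finset ℕ) (v : ℕ) : Finset (Finset ℕ) :=
  g ∪ (insert v s).powerset.filter fun t => t.Nonempty

/-- The set of `k`-simplices (sets of cardinality `k+1`) of the complex `g`. -/
def kSimplices (k : ℕ) (g : Finset (Finset ℕ)) : Finset (Finset ℕ) :=
  g.filter fun s => s.card = k + 1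

/-- The preferential attachment simplicial complex with parameters `k` and `δ`:
`G n ω` is the complex at time `n`, `choice n ω` is the `k`-simplex selected by the vertex
arriving at time `n ≥ 1`, chosen among the `k`-simplices of `G (n-1)` with conditional
probability proportional to its `k`-degree plus `δ`. -/
structure PAComplex (k : ℕ) (δ : ℝ) (Ω : Type*) [MeasurableSpace Ω] where
  μ : Measure Ω
  isProb : IsProbabilityMeasure μ
  G : ℕ → Ω → Finset (Finset ℕ)
  choice : ℕ → Ω → Finset ℕ
  meas_G : ∀ n, Measurable (G n)
  meas_choice : ∀ n, Measurable (choice n)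
  init : ∀ ω, G 0 ω = initComplex k
  choice_mem : ∀ n ω, 1 ≤ n → choice n ω ∈ kSimplices k (G (n - 1) ω)
  step : ∀ n ω, 1 ≤ n → G n ω = addSimplex (G (n - 1) ω) (choice n ω) (n + k + 2)
  cond_law : ∀ n : ℕ, 1 ≤ n → ∀ g : ℕ → Finset (Finset ℕ),
    ∀ s ∈ kSimplices k (g (n - 1)),
      μ {ω | choice n ω = s ∧ ∀ j < n, G j ω = g j}
        = ENNReal.ofReal (((simDeg k (g (n - 1)) s : ℝ) + δ) /
            ∑ t ∈ kSimplices k (g (n - 1)), ((simDeg k (g (n - 1)) t : ℝ) + δ)) *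
          μ {ω | ∀ j < n, G j ω = g j}

/-- The `c` largest vertices of the simplex `s` (so for an enumeration
`s = {v_0 < v_1 < ⋯ < v_k}` and `c = m+1` this is the youngest `m`-simplex
`{v_{k-m}, …, v_k}`). -/
def topSub (s : Finset ℕ) (c : ℕ) : Finset ℕ :=
  s.filter fun v => (s.filter fun w => v < w).card < c

/-- `Ncount k g i` is the number of `k`-simplices `s = {v_0 < ⋯ < v_k}` of `g` such that
for each `m = 0, …, k` the `m`-degree of the youngest `m`-simplex `{v_{k-m}, …, v_k}`
equals `i m`. -/
def Ncount (k : ℕ) (g : Finset (Finset ℕ)) (i : Fin (k + 1) → ℕ) : ℕ :=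
  ((kSimplices k g).filter fun s =>
    ∀ m : Fin (k + 1), simDeg (m : ℕ) g (topSub s ((m : ℕ) + 1)) = i m).card

open Classical in
/-- The expected degree count `m_n(i_0,…,i_k) = E[N_n(i_0,…,i_k)]`, with the convention
that it is `0` on index vectors violating `1 ≤ i_k < ⋯ < i_0`. -/
def mExp {k : ℕ} {δ : ℝ} {Ω : Type*} [MeasurableSpace Ω]
    (M : PAComplex k δ Ω) (n : ℕ) (i : Fin (k + 1) → ℕ) : ℝ :=
  if ValidIdx k i then ∫ ω, (Ncount k (M.G n ω) i : ℝ) ∂M.μ else 0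

/-- The number of simplices of `g` obtained from `T` by adding exactly one vertex. -/
def extDeg (g : Finset (Finset ℕ)) (T : Finset ℕ) : ℕ :=
  (g.filter fun t => T ⊆ t ∧ t.card = T.card + 1).card

/-- The total attachment weight of the `k`-simplices of `g` containing `T`. -/
def starWeight (k : ℕ) (δ : ℝ) (g : Finset (Finset ℕ)) (T : Finset ℕ) : ℝ :=
  ∑ t ∈ (kSimplices k g).filter (T ⊆ ·), ((simDeg k g t : ℝ) + δ)

/-- The complexes that the preferential attachment process can reach at time `n`. -/
inductive Reachable (k : ℕ) : ℕ → Finset (Finset ℕ) → Prop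
  | init : Reachable k 0 (initComplex k)
  | step (n : ℕ) (g : Finset (Finset ℕ)) (c : Finset ℕ) (hg : Reachable k n g)
      (hc : c ∈ kSimplices k g) : Reachable k (n + 1) (addSimplex g c (n + 1 + k + 2))

theorem simDeg_eq_extDeg {m : ℕ} {g : Finset (Finset ℕ)} {T : Finset ℕ} (h : T.card = m + 1) :
    simDeg m g T = extDeg g T := by
  simp only [simDeg, extDeg, h]

theorem mem_kSimplices {k : ℕ} {g : Finset (Finset ℕ)} {s : Finset ℕ} :
    s ∈ kSimplices k g ↔ s ∈ g ∧ s.card = k + 1 := by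
  simp [kSimplices]

theorem mem_addSimplex {g : Finset (Finset ℕ)} {c t : Finset ℕ} {v : ℕ} :
    t ∈ addSimplex g c v ↔ t ∈ g ∨ (t ⊆ insert v c ∧ t.Nonempty) := by
  simp [addSimplex]

theorem card_facet_extensions {A T : Finset ℕ} (h : T ⊆ A) :
    (A.powerset.filter fun t => T ⊆ t ∧ t.card = T.card + 1).card = A.card - T.card := by
  rw [← card_sdiff_of_subset h]
  have : (A.powerset.filter fun t => T ⊆ t ∧ t.card = T.card + 1)
      = (A \ T).image fun w => insert w T := by
    ext t
    simp only [mem_filter, mem_powerset, mem_image, Finset.mem_sdiff]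
    constructor
    · rintro ⟨htA, hTt, hc⟩
      have h1 : (t \ T).card = 1 := by rw [card_sdiff_of_subset hTt]; omega
      obtain ⟨w, hw⟩ := card_eq_one.1 h1
      have hwt : w ∈ t \ T := by simp [hw]
      rw [Finset.mem_sdiff] at hwt
      refine ⟨w, ⟨htA hwt.1, hwt.2⟩, ?_⟩
      rw [insert_eq, ← hw, sdiff_union_of_subset hTt]
    · rintro ⟨w, ⟨hwA, hwT⟩, rfl⟩
      exact ⟨insert_subset hwA h, subset_insert _ _, card_insert_of_notMem hwT⟩
  rw [this, card_image_of_injOn]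
  intro a ha b hb hab
  have ha' : a ∈ A \ T := ha
  rw [Finset.mem_sdiff] at ha'
  have : a ∈ insert b T := by
    have hab' : insert a T = insert b T := hab
    rw [← hab']; exact mem_insert_self _ _
  rcases mem_insert.1 this with h | h
  · exact h
  · exact absurd h ha'.2

theorem card_cofacets_containing {A T : Finset ℕ} (h : T ⊆ A) :
    (A.powerset.filter fun t => T ⊆ t ∧ t.card + 1 = A.card).card = A.card - T.card := by
  rw [← card_sdiff_of_subset h]
  have : (A.powerset.filter fun t => T ⊆ t ∧ t.card + 1 = A.card)
      = (A \ T).image fun w => A.erase w := by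
    ext t
    simp only [mem_filter, mem_powerset, mem_image, Finset.mem_sdiff]
    constructor
    · rintro ⟨htA, hTt, hc⟩
      have h1 : (A \ t).card = 1 := by rw [card_sdiff_of_subset htA]; omega
      obtain ⟨w, hw⟩ := card_eq_one.1 h1
      have hwt : w ∈ A \ t := by simp [hw]
      rw [Finset.mem_sdiff] at hwt
      refine ⟨w, ⟨hwt.1, fun hT => hwt.2 (hTt hT)⟩, ?_⟩
      rw [erase_eq, ← hw, Finset.sdiff_sdiff_eq_self htA]
    · rintro ⟨w, ⟨hwA, hwT⟩, rfl⟩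
      exact ⟨erase_subset _ _, subset_erase.2 ⟨h, hwT⟩, card_erase_add_one hwA⟩
  rw [this, card_image_of_injOn]
  intro a ha b hb hab
  have ha' : a ∈ A \ T := ha
  rw [Finset.mem_sdiff] at ha'
  by_contra hne
  have : a ∈ A.erase b := mem_erase.2 ⟨hne, ha'.1⟩
  have hab' : A.erase a = A.erase b := hab
  rw [← hab'] at this
  simp at this

section AddSimplex

variable {k : ℕ} {g : Finset (Finset ℕ)} {c T : Finset ℕ} {v : ℕ}

theorem extDeg_addSimplex_of_notMem (hd : ∀ t ∈ g, ∀ u ⊆ t, u.Nonempty → u ∈ g)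
    (hv : ∀ t ∈ g, v ∉ t) (hc : c ∈ g) (hT : v ∉ T) :
    extDeg (addSimplex g c v) T = extDeg g T + if T ⊆ c then 1 else 0 := by
  unfold extDeg
  split_ifs with hTc
  · have : ((addSimplex g c v).filter fun t => T ⊆ t ∧ t.card = T.card + 1)
        = insert (insert v T) (g.filter fun t => T ⊆ t ∧ t.card = T.card + 1) := by
      ext t
      simp only [mem_filter, mem_insert, mem_addSimplex]
      constructor
      · rintro ⟨h | ⟨h, hne⟩, hTt, hcard⟩
        · exact Or.inr ⟨h, hTt, hcard⟩
        · by_cases hvt : v ∈ t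
          · left
            refine (eq_of_subset_of_card_le (insert_subset hvt hTt) ?_).symm
            rw [card_insert_of_notMem hT, hcard]
          · exact Or.inr ⟨hd c hc t ((subset_insert_iff_of_notMem hvt).1 h) hne, hTt, hcard⟩
      · rintro (rfl | ⟨h, hTt, hcard⟩)
        · exact ⟨Or.inr ⟨insert_subset_insert _ hTc, insert_nonempty _ _⟩, subset_insert _ _,
            card_insert_of_notMem hT⟩
        · exact ⟨Or.inl h, hTt, hcard⟩
    rw [this, card_insert_of_notMem]
    intro h
    exact hv _ (mem_filter.1 h).1 (mem_insert_self _ _)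
  · rw [add_zero]
    congr 1
    ext t
    simp only [mem_filter, mem_addSimplex]
    constructor
    · rintro ⟨h | ⟨h, hne⟩, hTt, hcard⟩
      · exact ⟨h, hTt, hcard⟩
      · exact absurd ((subset_insert_iff_of_notMem hT).1 (hTt.trans h)) hTc
    · rintro ⟨h, h'⟩
      exact ⟨Or.inl h, h'⟩

theorem extDeg_addSimplex_of_mem (hv : ∀ t ∈ g, v ∉ t) (hT : v ∈ T) (hTc : T ⊆ insert v c) :
    extDeg (addSimplex g c v) T = (insert v c).card - T.card := by
  rw [← card_facet_extensions hTc]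
  unfold extDeg
  congr 1
  ext t
  simp only [mem_filter, mem_addSimplex, mem_powerset]
  constructor
  · rintro ⟨h | ⟨h, hne⟩, hTt, hcard⟩
    · exact absurd (hTt hT) (hv t h)
    · exact ⟨h, hTt, hcard⟩
  · rintro ⟨h, hTt, hcard⟩
    exact ⟨Or.inr ⟨h, v, hTt hT⟩, hTt, hcard⟩

/-- The `k`-simplices created when the vertex `v` attaches to the `k`-simplex `c`. -/
def newFaces (c : Finset ℕ) (v : ℕ) : Finset (Finset ℕ) :=
  (insert v c).powerset.filter fun t => v ∈ t ∧ t.card + 1 = (insert v c).card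

theorem card_newFaces_containing (hvc : v ∉ c) (hT : v ∉ T) :
    ((newFaces c v).filter (T ⊆ ·)).card = if T ⊆ c then c.card - T.card else 0 := by
  split_ifs with hTc
  · have h := card_cofacets_containing (insert_subset_insert v hTc)
    rw [card_insert_of_notMem hT, card_insert_of_notMem hvc, Nat.add_sub_add_right] at h
    rw [← h]
    congr 1
    ext t
    simp only [newFaces, mem_filter, mem_powerset, insert_subset_iff, card_insert_of_notMem hvc]
    tauto
  · rw [card_eq_zero, filter_eq_empty_iff]
    intro t ht hTt
    simp only [newFaces, mem_filter, mem_powerset] at ht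
    exact hTc ((subset_insert_iff_of_notMem hT).1 (hTt.trans ht.1))

theorem card_newFaces (hvc : v ∉ c) : (newFaces c v).card = c.card := by
  have h := card_newFaces_containing (T := ∅) hvc (by simp)
  simpa using h

theorem kSimplices_addSimplex (hd : ∀ t ∈ g, ∀ u ⊆ t, u.Nonempty → u ∈ g)
    (hv : ∀ t ∈ g, v ∉ t) (hc : c ∈ kSimplices k g) :
    kSimplices k (addSimplex g c v) = kSimplices k g ∪ newFaces c v := by
  rw [mem_kSimplices] at hc
  have hcard : (insert v c).card = k + 2 := by
    rw [card_insert_of_notMem (hv c hc.1), hc.2]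
  ext t
  simp only [mem_kSimplices, mem_addSimplex, mem_union, newFaces, mem_filter, mem_powerset, hcard]
  constructor
  · rintro ⟨h | ⟨h, hne⟩, ht⟩
    · exact Or.inl ⟨h, ht⟩
    · by_cases hvt : v ∈ t
      · exact Or.inr ⟨h, hvt, by omega⟩
      · exact Or.inl ⟨hd c hc.1 t ((subset_insert_iff_of_notMem hvt).1 h) hne, ht⟩
  · rintro (⟨h, ht⟩ | ⟨h, hvt, ht⟩)
    · exact ⟨Or.inl h, ht⟩
    · exact ⟨Or.inr ⟨h, v, hvt⟩, by omega⟩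

theorem disjoint_kSimplices_newFaces (hv : ∀ t ∈ g, v ∉ t) :
    Disjoint (kSimplices k g) (newFaces c v) := by
  rw [disjoint_left]
  intro t ht ht'
  exact hv t (mem_kSimplices.1 ht).1 (mem_filter.1 ht').2.1

theorem simDeg_addSimplex_of_mem_newFaces (hv : ∀ t ∈ g, v ∉ t) (hc : c ∈ kSimplices k g)
    {t : Finset ℕ} (ht : t ∈ newFaces c v) : simDeg k (addSimplex g c v) t = 1 := by
  rw [mem_kSimplices] at hc
  have hcard : (insert v c).card = k + 2 := by
    rw [card_insert_of_notMem (hv c hc.1), hc.2]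
  simp only [newFaces, mem_filter, mem_powerset, hcard] at ht
  rw [simDeg_eq_extDeg (by omega), extDeg_addSimplex_of_mem hv ht.2.1 ht.1]
  omega

theorem simDeg_addSimplex_of_mem_kSimplices (hd : ∀ t ∈ g, ∀ u ⊆ t, u.Nonempty → u ∈ g)
    (hv : ∀ t ∈ g, v ∉ t) (hc : c ∈ kSimplices k g) {t : Finset ℕ} (ht : t ∈ kSimplices k g) :
    simDeg k (addSimplex g c v) t = simDeg k g t + if t = c then 1 else 0 := by
  rw [mem_kSimplices] at hc ht
  rw [simDeg_eq_extDeg ht.2, simDeg_eq_extDeg ht.2,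
    extDeg_addSimplex_of_notMem hd hv hc.1 (hv t ht.1)]
  congr 1
  have : t ⊆ c ↔ t = c :=
    ⟨fun h => eq_of_subset_of_card_le h (by omega), fun h => h.subset⟩
  simp only [this]

theorem starWeight_addSimplex_of_notMem (δ : ℝ) (hd : ∀ t ∈ g, ∀ u ⊆ t, u.Nonempty → u ∈ g)
    (hv : ∀ t ∈ g, v ∉ t) (hc : c ∈ kSimplices k g) (hT : v ∉ T) :
    starWeight k δ (addSimplex g c v) T = starWeight k δ g T
      + if T ⊆ c then 1 + ((k : ℝ) + 1 - T.card) * (1 + δ) else 0 := by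
  have hc' := mem_kSimplices.1 hc
  unfold starWeight
  rw [kSimplices_addSimplex hd hv hc, filter_union, sum_union
    (disjoint_filter_filter (disjoint_kSimplices_newFaces hv))]
  have h1 : ∑ t ∈ (kSimplices k g).filter (T ⊆ ·), ((simDeg k (addSimplex g c v) t : ℝ) + δ)
      = ∑ t ∈ (kSimplices k g).filter (T ⊆ ·), ((simDeg k g t : ℝ) + δ)
        + if T ⊆ c then 1 else 0 := by
    have : (if T ⊆ c then (1 : ℝ) else 0)
        = ∑ t ∈ (kSimplices k g).filter (T ⊆ ·), if t = c then 1 else 0 := by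
      simp [hc]
    rw [this, ← sum_add_distrib]
    refine sum_congr rfl fun t ht => ?_
    rw [simDeg_addSimplex_of_mem_kSimplices hd hv hc (mem_filter.1 ht).1]
    push_cast
    ring
  have h2 : ∑ t ∈ (newFaces c v).filter (T ⊆ ·), ((simDeg k (addSimplex g c v) t : ℝ) + δ)
      = if T ⊆ c then ((k : ℝ) + 1 - T.card) * (1 + δ) else 0 := by
    rw [sum_congr rfl (g := fun _ => 1 + δ), sum_const,
      card_newFaces_containing (hv c hc'.1) hT]
    · split_ifs with hTc
      · have := card_le_card hTc
        rw [hc'.2] at this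
        rw [hc'.2, nsmul_eq_mul, Nat.cast_sub this]
        push_cast
        ring
      · simp
    · intro t ht
      rw [simDeg_addSimplex_of_mem_newFaces hv hc (mem_filter.1 ht).1]
      simp
  rw [h1, h2, add_assoc]
  congr 1
  split_ifs <;> simp

theorem starWeight_addSimplex_of_mem (δ : ℝ)
    (hv : ∀ t ∈ g, v ∉ t) (hc : c ∈ kSimplices k g) (hT : v ∈ T) (hTc : T ⊆ insert v c) :
    starWeight k δ (addSimplex g c v) T = ((k : ℝ) + 2 - T.card) * (1 + δ) := by
  have hc' := mem_kSimplices.1 hc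
  have hcard : (insert v c).card = k + 2 := by
    rw [card_insert_of_notMem (hv c hc'.1), hc'.2]
  have hTk : T.card ≤ k + 2 := hcard ▸ card_le_card hTc
  have : (kSimplices k (addSimplex g c v)).filter (T ⊆ ·)
      = (insert v c).powerset.filter fun t => T ⊆ t ∧ t.card + 1 = (insert v c).card := by
    ext t
    simp only [mem_filter, mem_kSimplices, mem_addSimplex, mem_powerset, hcard]
    constructor
    · rintro ⟨⟨h | h, ht⟩, hTt⟩
      · exact absurd (hTt hT) (hv t h)
      · exact ⟨h.1, hTt, by omega⟩
    · rintro ⟨h, hTt, ht⟩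
      exact ⟨⟨Or.inr ⟨h, v, hTt hT⟩, by omega⟩, hTt⟩
  unfold starWeight
  rw [this, sum_congr rfl (g := fun _ => 1 + δ), sum_const, card_cofacets_containing hTc, hcard,
    nsmul_eq_mul, Nat.cast_sub hTk]
  · push_cast
    ring
  · intro t ht
    simp only [mem_filter, mem_powerset] at ht
    rw [simDeg_addSimplex_of_mem_newFaces hv hc
      (mem_filter.2 ⟨mem_powerset.2 ht.1, ht.2.1 hT, ht.2.2⟩)]
    simp

end AddSimplex

namespace Reachable

variable {k n : ℕ} {g : Finset (Finset ℕ)}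

theorem subset_Icc (hg : Reachable k n g) : ∀ t ∈ g, t ⊆ Finset.Icc 1 (n + k + 2) := by
  induction hg with
  | init =>
    intro t ht
    simp only [initComplex, mem_filter, mem_powerset] at ht
    simpa using ht.1
  | step n g c hg hc ih =>
    have hmono : Finset.Icc 1 (n + k + 2) ⊆ Finset.Icc 1 (n + 1 + k + 2) :=
      Finset.Icc_subset_Icc le_rfl (by omega)
    intro t ht
    rcases mem_addSimplex.1 ht with h | ⟨h, -⟩
    · exact (ih t h).trans hmono
    · exact h.trans (insert_subset (by simp) ((ih c (mem_kSimplices.1 hc).1).trans hmono))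

theorem fresh (hg : Reachable k n g) : ∀ t ∈ g, n + 1 + k + 2 ∉ t := by
  intro t ht h
  have := Finset.mem_Icc.1 (hg.subset_Icc t ht h)
  omega

theorem down_closed (hg : Reachable k n g) : ∀ t ∈ g, ∀ u ⊆ t, u.Nonempty → u ∈ g := by
  induction hg with
  | init =>
    intro t ht u hu hne
    simp only [initComplex, mem_filter, mem_powerset] at ht ⊢
    exact ⟨hu.trans ht.1, hne⟩
  | step n g c hg hc ih =>
    intro t ht u hu hne
    rcases mem_addSimplex.1 ht with h | ⟨h, -⟩
    · exact mem_addSimplex.2 (Or.inl (ih t h u hu hne))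
    · exact mem_addSimplex.2 (Or.inr ⟨hu.trans h, hne⟩)

theorem extDeg_initComplex {T : Finset ℕ} (hT : T ⊆ Finset.Icc 1 (k + 2)) :
    extDeg (initComplex k) T = k + 2 - T.card := by
  have h := card_facet_extensions hT
  rw [Nat.card_Icc, Nat.add_sub_cancel] at h
  rw [← h]
  unfold extDeg initComplex
  congr 1
  ext t
  simp only [mem_filter, mem_powerset]
  constructor
  · tauto
  · rintro ⟨h, hTt, hc⟩
    exact ⟨⟨h, card_pos.1 (by omega)⟩, hTt, hc⟩

theorem simDeg_initComplex {t : Finset ℕ} (ht : t ∈ kSimplices k (initComplex k)) :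
    simDeg k (initComplex k) t = 1 := by
  simp only [mem_kSimplices, initComplex, mem_filter, mem_powerset] at ht
  rw [simDeg_eq_extDeg ht.2, extDeg_initComplex ht.1.1]
  omega

theorem simDeg_pos (hg : Reachable k n g) : ∀ t ∈ kSimplices k g, 1 ≤ simDeg k g t := by
  induction hg with
  | init => exact fun t ht => (simDeg_initComplex ht).ge
  | step n g c hg hc ih =>
    intro t ht
    rw [kSimplices_addSimplex hg.down_closed hg.fresh hc, mem_union] at ht
    rcases ht with ht | ht
    · rw [simDeg_addSimplex_of_mem_kSimplices hg.down_closed hg.fresh hc ht]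
      exact (ih t ht).trans (Nat.le_add_right _ _)
    · exact (simDeg_addSimplex_of_mem_newFaces hg.fresh hc ht).ge

theorem starWeight_initComplex (δ : ℝ) {T : Finset ℕ} (hT : T ⊆ Finset.Icc 1 (k + 2)) :
    starWeight k δ (initComplex k) T = ((k : ℝ) + 2 - T.card) * (1 + δ) := by
  have hTk : T.card ≤ k + 2 := by simpa using card_le_card hT
  have : (kSimplices k (initComplex k)).filter (T ⊆ ·)
      = (Finset.Icc 1 (k + 2)).powerset.filter
        fun t => T ⊆ t ∧ t.card + 1 = (Finset.Icc 1 (k + 2)).card := by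
    ext t
    simp only [mem_filter, mem_kSimplices, initComplex, mem_powerset, Nat.card_Icc,
      Nat.add_sub_cancel]
    constructor
    · rintro ⟨⟨h, ht⟩, hTt⟩
      exact ⟨h.1, hTt, by omega⟩
    · rintro ⟨h, hTt, ht⟩
      exact ⟨⟨⟨h, card_pos.1 (by omega)⟩, by omega⟩, hTt⟩
  unfold starWeight
  rw [sum_congr rfl (g := fun _ => 1 + δ), this, sum_const, card_cofacets_containing hT,
    Nat.card_Icc, Nat.add_sub_cancel, nsmul_eq_mul, Nat.cast_sub hTk]
  · push_cast
    ring
  · intro t ht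
    rw [simDeg_initComplex (mem_filter.1 ht).1]
    simp

/-- The attachment weight of the star of a simplex is an affine function of its degree. The empty
simplex is included, which gives the total weight. -/
theorem starWeight_eq (δ : ℝ) (hg : Reachable k n g) :
    ∀ T : Finset ℕ, T = ∅ ∨ T ∈ g → starWeight k δ g T
      = ((extDeg g T : ℝ) - k - 1 + T.card) * ((k : ℝ) + 2 - T.card + δ * ((k : ℝ) + 1 - T.card))
        + δ := by
  induction hg with
  | init =>
    intro T hT
    have hT' : T ⊆ Finset.Icc 1 (k + 2) := by
      rcases hT with rfl | hT
      · simp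
      · simp only [initComplex, mem_filter, mem_powerset] at hT
        exact hT.1
    have hTk : T.card ≤ k + 2 := by simpa using card_le_card hT'
    rw [starWeight_initComplex δ hT', extDeg_initComplex hT', Nat.cast_sub hTk]
    push_cast
    ring
  | step n g c hg hc ih =>
    intro T hT
    have hc' := mem_kSimplices.1 hc
    by_cases hvT : n + 1 + k + 2 ∈ T
    · have hTc : T ⊆ insert (n + 1 + k + 2) c := by
        rcases hT with rfl | hT
        · simp
        · rcases mem_addSimplex.1 hT with h | h
          · exact absurd hvT (hg.fresh T h)
          · exact h.1
      have hcard : (insert (n + 1 + k + 2) c).card = k + 2 := by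
        rw [card_insert_of_notMem (hg.fresh c hc'.1), hc'.2]
      have hTk : T.card ≤ k + 2 := hcard ▸ card_le_card hTc
      rw [starWeight_addSimplex_of_mem δ hg.fresh hc hvT hTc,
        extDeg_addSimplex_of_mem hg.fresh hvT hTc, hcard, Nat.cast_sub hTk]
      push_cast
      ring
    · have hT' : T = ∅ ∨ T ∈ g := by
        rcases hT with hT | hT
        · exact Or.inl hT
        · rcases mem_addSimplex.1 hT with h | ⟨h, hne⟩
          · exact Or.inr h
          · exact Or.inr (hg.down_closed c hc'.1 T ((subset_insert_iff_of_notMem hvT).1 h) hne)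
      rw [starWeight_addSimplex_of_notMem δ hg.down_closed hg.fresh hc hvT,
        extDeg_addSimplex_of_notMem hg.down_closed hg.fresh hc'.1 hvT, ih T hT']
      split_ifs
      · push_cast
        ring
      · simp

theorem extDeg_empty (hg : Reachable k n g) : extDeg g ∅ = n + k + 2 := by
  induction hg with
  | init =>
    rw [extDeg_initComplex (by simp)]
    simp
  | step n g c hg hc ih =>
    rw [extDeg_addSimplex_of_notMem hg.down_closed hg.fresh (mem_kSimplices.1 hc).1 (by simp), ih]
    simp
    omega

theorem sum_weight (δ : ℝ) (hg : Reachable k n g) :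
    ∑ t ∈ kSimplices k g, ((simDeg k g t : ℝ) + δ) = tauc k δ * ((n : ℝ) + 1) + δ := by
  have h := hg.starWeight_eq δ ∅ (Or.inl rfl)
  rw [hg.extDeg_empty] at h
  simp only [starWeight, empty_subset, filter_true, card_empty] at h
  rw [h, tauc]
  push_cast
  ring

end Reachable

theorem topSub_subset (s : Finset ℕ) (c : ℕ) : topSub s c ⊆ s := filter_subset _ _

theorem topSub_mono (s : Finset ℕ) : Monotone (topSub s) := by
  intro a b hab v hv
  rw [topSub, mem_filter] at hv ⊢
  exact ⟨hv.1, hv.2.trans_le hab⟩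

theorem card_topSub {s : Finset ℕ} {c : ℕ} (hc : c ≤ s.card) : (topSub s c).card = c := by
  set r : ℕ → ℕ := fun v => (s.filter fun w => v < w).card with hr
  have hlt : ∀ a ∈ s, ∀ b ∈ s, a < b → r b < r a := by
    intro a _ b hb hab
    refine card_lt_card ⟨fun w hw => ?_, fun h => ?_⟩
    · rw [mem_filter] at hw ⊢
      exact ⟨hw.1, hab.trans hw.2⟩
    · have := h (mem_filter.2 ⟨hb, hab⟩)
      simp at this
  have hinj : Set.InjOn r s := by
    intro a ha b hb hab
    by_contra hne
    rcases lt_or_gt_of_ne hne with h | h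
    · exact (hlt a ha b hb h).ne' hab
    · exact (hlt b hb a ha h).ne hab
  have himg : s.image r = range s.card := by
    refine eq_of_subset_of_card_le (fun x hx => ?_) ?_
    · obtain ⟨v, hv, rfl⟩ := mem_image.1 hx
      rw [mem_range]
      refine card_lt_card ⟨filter_subset _ _, fun h => ?_⟩
      have := h hv
      simp at this
    · rw [card_image_of_injOn hinj, card_range]
  have htop : (topSub s c).image r = range c := by
    ext x
    rw [mem_range]
    constructor
    · intro hx
      obtain ⟨v, hv, rfl⟩ := mem_image.1 hx
      exact (mem_filter.1 hv).2
    · intro hx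
      have : x ∈ s.image r := himg ▸ mem_range.2 (hx.trans_le hc)
      obtain ⟨v, hv, rfl⟩ := mem_image.1 this
      exact mem_image_of_mem r (mem_filter.2 ⟨hv, hx⟩)
  have h := card_image_of_injOn (hinj.mono (topSub_subset s c))
  rw [htop, card_range] at h
  exact h.symm

theorem topSub_card (s : Finset ℕ) : topSub s s.card = s :=
  eq_of_subset_of_card_le (topSub_subset _ _) (card_topSub le_rfl).ge

/-- The vector of degrees of the youngest subsimplices of the `k`-simplex `s`. -/
def degVec (k : ℕ) (g : Finset (Finset ℕ)) (s : Finset ℕ) : Fin (k + 1) → ℕ :=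
  fun m => simDeg (m : ℕ) g (topSub s ((m : ℕ) + 1))

theorem degVec_eq_extDeg {k : ℕ} (g : Finset (Finset ℕ)) {s : Finset ℕ} (hs : s.card = k + 1)
    (m : Fin (k + 1)) : degVec k g s m = extDeg g (topSub s ((m : ℕ) + 1)) :=
  simDeg_eq_extDeg (card_topSub (by omega))

theorem Ncount_eq_sum (k : ℕ) (g : Finset (Finset ℕ)) (i : Fin (k + 1) → ℕ) :
    (Ncount k g i : ℝ) = ∑ s ∈ kSimplices k g, if ∀ m, degVec k g s m = i m then (1 : ℝ) else 0 := by
  rw [Ncount, card_filter]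
  push_cast
  rfl

theorem extDeg_insert_lt {g : Finset (Finset ℕ)} {T : Finset ℕ} {w : ℕ}
    (hd : ∀ t ∈ g, ∀ u ⊆ t, u.Nonempty → u ∈ g) (hT : T.Nonempty) (hw : w ∉ T)
    (hTg : insert w T ∈ g) : extDeg g (insert w T) < extDeg g T := by
  unfold extDeg
  set A := g.filter fun t => insert w T ⊆ t ∧ t.card = (insert w T).card + 1 with hA
  have hmem : ∀ t ∈ A, t ∈ g ∧ w ∈ t ∧ T ⊆ t ∧ t.card = T.card + 2 := by
    intro t ht
    simp only [hA, mem_filter, insert_subset_iff, card_insert_of_notMem hw] at ht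
    exact ⟨ht.1, ht.2.1.1, ht.2.1.2, by omega⟩
  have hinj : Set.InjOn (fun t : Finset ℕ => t.erase w) A := by
    intro a ha b hb hab
    have hab' : a.erase w = b.erase w := hab
    rw [← insert_erase (hmem a ha).2.1, hab', insert_erase (hmem b hb).2.1]
  have hnot : insert w T ∉ A.image fun t => t.erase w := by
    intro h
    obtain ⟨t, -, ht⟩ := mem_image.1 h
    have : w ∈ t.erase w := by rw [ht]; exact mem_insert_self _ _
    simp at this
  rw [Nat.lt_iff_add_one_le, ← card_image_of_injOn hinj, ← card_insert_of_notMem hnot]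
  refine card_le_card fun t ht => ?_
  rcases mem_insert.1 ht with rfl | ht
  · exact mem_filter.2 ⟨hTg, subset_insert _ _, card_insert_of_notMem hw⟩
  · obtain ⟨u, hu, rfl⟩ := mem_image.1 ht
    obtain ⟨hug, hwu, hTu, hc⟩ := hmem u hu
    have hsub : T ⊆ u.erase w := subset_erase.2 ⟨hTu, hw⟩
    refine mem_filter.2 ⟨hd u hug _ (erase_subset _ _) (hT.mono hsub), hsub, ?_⟩
    rw [card_erase_of_mem hwu]
    omega

/-- Splitting the event that the incremented degree vector equals `i` according to how many
coordinates are incremented. -/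
theorem indicator_split {k : ℕ} (p : Fin (k + 1) → Prop) [DecidablePred p] (hp : Antitone p)
    (i d : Fin (k + 1) → ℕ) (hi : ∀ m, 1 ≤ i m) :
    (if ∀ m, d m + (if p m then 1 else 0) = i m then (1 : ℝ) else 0)
      = (if ∀ m, d m = i m then (1 : ℝ) else 0) * (1 - if p 0 then 1 else 0)
        + (∑ m : Fin k, (if ∀ ℓ, d ℓ = decUpTo k m i ℓ then (1 : ℝ) else 0)
          * ((if p m.castSucc then 1 else 0) - if p m.succ then 1 else 0))
        + (if ∀ ℓ, d ℓ = allDec k i ℓ then (1 : ℝ) else 0) * if p (Fin.last k) then 1 else 0 := by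
  have hdec : ∀ m, d m + 1 = i m ↔ d m = i m - 1 := fun m => by have := hi m; omega
  by_cases h0 : p 0
  · by_cases hk : p (Fin.last k)
    · have hall : ∀ m, p m := fun m => hp (Fin.le_last m) hk
      simp only [hall, if_true, sub_self, mul_zero, sum_const_zero, zero_add, mul_one]
      exact if_congr (forall_congr' hdec) rfl rfl
    · obtain ⟨m, hm, hm'⟩ : ∃ m : Fin k, p m.castSucc ∧ ¬ p m.succ := by
        by_contra! hcon
        exact hk (Fin.induction (motive := p) h0 hcon (Fin.last k))
      rw [sum_eq_single m]
      · simp only [h0, hk, hm, hm', if_true, if_false, sub_self, mul_zero, zero_add, add_zero,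
          sub_zero, mul_one]
        refine if_congr (forall_congr' fun ℓ => ?_) rfl rfl
        by_cases hℓ : (ℓ : ℕ) ≤ m
        · have : p ℓ := hp (show ℓ ≤ m.castSucc from hℓ) hm
          simp [this, decUpTo, hℓ, hdec]
        · have : ¬ p ℓ := fun h => hm' (hp (Fin.le_def.2 (by simp; omega)) h)
          simp [this, decUpTo, hℓ]
      · intro m' _ hne
        rcases lt_or_gt_of_ne hne with h | h
        · have h1 : p m'.succ := hp (Fin.le_def.2 (by simpa using Nat.succ_le_of_lt h)) hm
          have h2 : p m'.castSucc := hp (Fin.castSucc_lt_succ).le h1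
          simp [h1, h2]
        · have h1 : ¬ p m'.castSucc := fun hh =>
            hm' (hp (Fin.le_def.2 (by simpa using Nat.succ_le_of_lt h)) hh)
          have h2 : ¬ p m'.succ := fun hh => h1 (hp (Fin.castSucc_lt_succ).le hh)
          simp [h1, h2]
      · simp
  · have hall : ∀ m, ¬ p m := fun m h => h0 (hp (Fin.zero_le m) h)
    simp [hall]

theorem ValidIdx.one_le {k : ℕ} {i : Fin (k + 1) → ℕ} (hi : ValidIdx k i) (m : Fin (k + 1)) :
    1 ≤ i m :=
  hi.1.trans (hi.2.antitone (Fin.le_last m))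

namespace Reachable

variable {k n : ℕ} {g : Finset (Finset ℕ)}

theorem topSub_mem (hg : Reachable k n g) {s : Finset ℕ} (hs : s ∈ kSimplices k g) {m : ℕ}
    (hm : m ≤ k) : topSub s (m + 1) ∈ g := by
  rw [mem_kSimplices] at hs
  refine hg.down_closed s hs.1 _ (topSub_subset _ _) (card_pos.1 ?_)
  rw [card_topSub (by omega)]
  omega

theorem validIdx_degVec (hg : Reachable k n g) {s : Finset ℕ} (hs : s ∈ kSimplices k g) :
    ValidIdx k (degVec k g s) := by
  have hs' := mem_kSimplices.1 hs
  constructor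
  · have : topSub s (k + 1) = s := hs'.2 ▸ topSub_card s
    simp only [degVec, Fin.val_last, this]
    exact hg.simDeg_pos s hs
  · rw [Fin.strictAnti_iff_succ_lt]
    intro m
    rw [degVec_eq_extDeg g hs'.2, degVec_eq_extDeg g hs'.2, Fin.val_succ, Fin.val_castSucc]
    have h1 : (topSub s ((m : ℕ) + 1)).card = m + 1 := card_topSub (by omega)
    have h2 : (topSub s ((m : ℕ) + 1 + 1)).card = m + 1 + 1 := card_topSub (by omega)
    have hsub : topSub s ((m : ℕ) + 1) ⊆ topSub s ((m : ℕ) + 1 + 1) := topSub_mono s (by omega)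
    have h3 : (topSub s ((m : ℕ) + 1 + 1) \ topSub s ((m : ℕ) + 1)).card = 1 := by
      rw [card_sdiff_of_subset hsub]
      omega
    obtain ⟨w, hw⟩ := card_eq_one.1 h3
    have hw' : w ∈ topSub s ((m : ℕ) + 1 + 1) \ topSub s ((m : ℕ) + 1) := by simp [hw]
    have hins : insert w (topSub s ((m : ℕ) + 1)) = topSub s ((m : ℕ) + 1 + 1) := by
      rw [insert_eq, ← hw, sdiff_union_of_subset hsub]
    rw [← hins]
    refine extDeg_insert_lt hg.down_closed (card_pos.1 (by omega)) (Finset.mem_sdiff.1 hw').2 ?_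
    rw [hins]
    exact hg.topSub_mem hs (by omega)

theorem Ncount_eq_zero (hg : Reachable k n g) {i : Fin (k + 1) → ℕ} (hi : ¬ ValidIdx k i) :
    Ncount k g i = 0 := by
  rw [Ncount, card_eq_zero, filter_eq_empty_iff]
  intro s hs h
  exact hi ((funext h : degVec k g s = i) ▸ hg.validIdx_degVec hs)

theorem Ncount_addSimplex (hg : Reachable k n g) {c : Finset ℕ} (hc : c ∈ kSimplices k g)
    (i : Fin (k + 1) → ℕ) :
    (Ncount k (addSimplex g c (n + 1 + k + 2)) i : ℝ)
      = (∑ s ∈ kSimplices k g, if ∀ m : Fin (k + 1), degVec k g s m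
            + (if topSub s ((m : ℕ) + 1) ⊆ c then 1 else 0) = i m then (1 : ℝ) else 0)
        + ((k : ℝ) + 1)
          * (if ∀ ℓ : Fin (k + 1), i ℓ = k - (ℓ : ℕ) + 1 then (1 : ℝ) else 0) := by
  have hc' := mem_kSimplices.1 hc
  rw [Ncount_eq_sum, kSimplices_addSimplex hg.down_closed hg.fresh hc,
    sum_union (disjoint_kSimplices_newFaces hg.fresh)]
  congr 1
  · refine sum_congr rfl fun s hs => ?_
    have hs' := mem_kSimplices.1 hs
    refine if_congr (forall_congr' fun m => ?_) rfl rfl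
    rw [degVec_eq_extDeg _ hs'.2, degVec_eq_extDeg _ hs'.2,
      extDeg_addSimplex_of_notMem hg.down_closed hg.fresh hc'.1
        (fun h => hg.fresh s hs'.1 (topSub_subset _ _ h))]
  · have hcard : (insert (n + 1 + k + 2) c).card = k + 2 := by
      rw [card_insert_of_notMem (hg.fresh c hc'.1), hc'.2]
    rw [sum_congr rfl (g := fun _ => if ∀ ℓ : Fin (k + 1), i ℓ = k - (ℓ : ℕ) + 1
      then (1 : ℝ) else 0), sum_const, card_newFaces (hg.fresh c hc'.1), hc'.2, nsmul_eq_mul]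
    · push_cast
      rfl
    · intro s hs
      simp only [newFaces, mem_filter, mem_powerset, hcard] at hs
      refine if_congr (forall_congr' fun m => ?_) rfl rfl
      have hsk : s.card = k + 1 := by omega
      have hv : n + 1 + k + 2 ∈ topSub s ((m : ℕ) + 1) := by
        refine mem_filter.2 ⟨hs.2.1, ?_⟩
        rw [filter_eq_empty_iff.2, card_empty]
        · omega
        · intro w hw
          rcases mem_insert.1 (hs.1 hw) with rfl | hw
          · exact lt_irrefl _
          · have := Finset.mem_Icc.1 (hg.subset_Icc c hc'.1 hw)
            omega
      rw [degVec_eq_extDeg _ hsk,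
        extDeg_addSimplex_of_mem hg.fresh hv ((topSub_subset _ _).trans hs.1), hcard,
        card_topSub (by omega)]
      omega

theorem starWeight_topSub (δ : ℝ) (hg : Reachable k n g) {s : Finset ℕ}
    (hs : s ∈ kSimplices k g) (m : Fin (k + 1)) :
    starWeight k δ g (topSub s ((m : ℕ) + 1))
      = ((degVec k g s m : ℝ) - k + (m : ℕ)) * bcoef k δ m + δ := by
  have hs' := mem_kSimplices.1 hs
  rw [hg.starWeight_eq δ _ (Or.inr (hg.topSub_mem hs (by omega))), degVec_eq_extDeg _ hs'.2,
    card_topSub (by omega), bcoef]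
  push_cast
  ring

theorem sum_weight_mul_indicator (δ : ℝ) (hg : Reachable k n g) {i : Fin (k + 1) → ℕ}
    (hi : ValidIdx k i) {s : Finset ℕ} (hs : s ∈ kSimplices k g) :
    ∑ c ∈ kSimplices k g, ((simDeg k g c : ℝ) + δ) * (if ∀ m : Fin (k + 1), degVec k g s m
        + (if topSub s ((m : ℕ) + 1) ⊆ c then 1 else 0) = i m then (1 : ℝ) else 0)
      = (tauc k δ * ((n : ℝ) + 1) + δ - (((i 0 : ℝ) - k) * bcoef k δ 0 + δ))
          * (if ∀ m, degVec k g s m = i m then (1 : ℝ) else 0)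
        + ((i (Fin.last k) : ℝ) - 1 + δ)
          * (if ∀ m, degVec k g s m = allDec k i m then (1 : ℝ) else 0)
        + ∑ m : Fin k,
          (((i m.castSucc : ℝ) - k + (m : ℕ) - 1) * bcoef k δ (m : ℕ)
            - ((i m.succ : ℝ) - k + (m : ℕ) + 1) * bcoef k δ ((m : ℕ) + 1))
          * (if ∀ ℓ, degVec k g s ℓ = decUpTo k m i ℓ then (1 : ℝ) else 0) := by
  have hstar : ∀ m : Fin (k + 1), ∑ c ∈ kSimplices k g, ((simDeg k g c : ℝ) + δ)
      * (if topSub s ((m : ℕ) + 1) ⊆ c then (1 : ℝ) else 0)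
      = ((degVec k g s m : ℝ) - k + (m : ℕ)) * bcoef k δ m + δ := by
    intro m
    rw [← hg.starWeight_topSub δ hs m, starWeight, sum_filter]
    simp
  have hsplit : ∀ c ∈ kSimplices k g, ((simDeg k g c : ℝ) + δ)
      * (if ∀ m : Fin (k + 1), degVec k g s m
        + (if topSub s ((m : ℕ) + 1) ⊆ c then 1 else 0) = i m then (1 : ℝ) else 0)
      = (if ∀ m, degVec k g s m = i m then (1 : ℝ) else 0)
          * (((simDeg k g c : ℝ) + δ) - ((simDeg k g c : ℝ) + δ)
            * (if topSub s (((0 : Fin (k + 1)) : ℕ) + 1) ⊆ c then (1 : ℝ) else 0))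
        + (∑ m : Fin k, (if ∀ ℓ, degVec k g s ℓ = decUpTo k m i ℓ then (1 : ℝ) else 0)
          * (((simDeg k g c : ℝ) + δ)
              * (if topSub s ((m.castSucc : ℕ) + 1) ⊆ c then (1 : ℝ) else 0)
            - ((simDeg k g c : ℝ) + δ)
              * (if topSub s ((m.succ : ℕ) + 1) ⊆ c then (1 : ℝ) else 0)))
        + (if ∀ ℓ, degVec k g s ℓ = allDec k i ℓ then (1 : ℝ) else 0)
          * (((simDeg k g c : ℝ) + δ)
            * (if topSub s ((Fin.last k : ℕ) + 1) ⊆ c then (1 : ℝ) else 0)) := by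
    intro c _
    rw [indicator_split (fun m : Fin (k + 1) => topSub s ((m : ℕ) + 1) ⊆ c)
      (fun a b hab h => (topSub_mono s (Nat.succ_le_succ hab)).trans h) i _ hi.one_le,
      mul_add, mul_add, mul_sum]
    congr 1
    · congr 1
      · ring
      · exact sum_congr rfl fun m _ => by ring
    · ring
  rw [sum_congr rfl hsplit, sum_add_distrib, sum_add_distrib, sum_comm]
  simp only [← mul_sum, sum_sub_distrib, hstar, hg.sum_weight δ]
  rw [add_right_comm]
  congr 1
  · congr 1
    · split_ifs with h
      · rw [h 0]
        simp
      · simp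
    · split_ifs with h
      · have h1 := hi.one_le (Fin.last k)
        rw [h (Fin.last k), allDec, Nat.cast_sub h1, bcoef]
        simp
      · simp
  · refine sum_congr rfl fun m _ => ?_
    split_ifs with h
    · have h1 := hi.one_le m.castSucc
      rw [h m.castSucc, h m.succ]
      simp only [decUpTo, Fin.val_castSucc, le_refl, if_true, Fin.val_succ,
        Nat.not_succ_le_self, if_false, Nat.cast_sub h1]
      push_cast
      ring
    · simp

/-- The one-step drift of the degree counts, multiplied by the total attachment weight. -/
theorem sum_weight_mul_Ncount (δ : ℝ) (hg : Reachable k n g) {i : Fin (k + 1) → ℕ}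
    (hi : ValidIdx k i) :
    ∑ c ∈ kSimplices k g, ((simDeg k g c : ℝ) + δ)
        * (Ncount k (addSimplex g c (n + 1 + k + 2)) i : ℝ)
      = (tauc k δ * ((n : ℝ) + 1) + δ - (((i 0 : ℝ) - k) * bcoef k δ 0 + δ)) * (Ncount k g i : ℝ)
        + ((i (Fin.last k) : ℝ) - 1 + δ) * (Ncount k g (allDec k i) : ℝ)
        + (∑ m : Fin k,
          (((i m.castSucc : ℝ) - k + (m : ℕ) - 1) * bcoef k δ (m : ℕ)
            - ((i m.succ : ℝ) - k + (m : ℕ) + 1) * bcoef k δ ((m : ℕ) + 1))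
          * (Ncount k g (decUpTo k m i) : ℝ))
        + (tauc k δ * ((n : ℝ) + 1) + δ) * (((k : ℝ) + 1)
          * (if ∀ ℓ : Fin (k + 1), i ℓ = k - (ℓ : ℕ) + 1 then (1 : ℝ) else 0)) := by
  rw [sum_congr rfl fun c hc => by rw [hg.Ncount_addSimplex hc i, mul_add, mul_sum],
    sum_add_distrib, ← sum_mul, hg.sum_weight δ, sum_comm,
    sum_congr rfl fun s hs => hg.sum_weight_mul_indicator δ hi hs]
  simp only [sum_add_distrib, ← mul_sum, Ncount_eq_sum]
  rw [sum_comm]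
  simp only [mul_sum]

end Reachable

theorem tauc_mul_add_pos {k : ℕ} {δ : ℝ} (hδ : -1 < δ) (n : ℕ) :
    0 < tauc k δ * ((n : ℝ) + 1) + δ := by
  have h : 0 < 1 + δ := by linarith
  have h1 : tauc k δ * ((n : ℝ) + 1) + δ
      = ((k : ℝ) + 2) * (1 + δ) + (1 + ((k : ℝ) + 1) * (1 + δ)) * n := by
    rw [tauc]
    ring
  rw [h1]
  positivity

theorem integral_comp_eq_sum {Ω α : Type*} [MeasurableSpace Ω] (μ : Measure Ω) [IsFiniteMeasure μ]
    (X : Ω → α) (U : Finset α) (hX : ∀ a, MeasurableSet {ω | X ω = a}) (hU : ∀ ω, X ω ∈ U)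
    (f : α → ℝ) : ∫ ω, f (X ω) ∂μ = ∑ a ∈ U, μ.real {ω | X ω = a} * f a := by
  classical
  have h : ∀ ω, f (X ω) = ∑ a ∈ U, {ω | X ω = a}.indicator (fun _ => f a) ω := by
    intro ω
    rw [sum_eq_single_of_mem (X ω) (hU ω)]
    · simp
    · intro b _ hb
      exact Set.indicator_of_notMem (fun h : X ω = b => hb h.symm) _
  simp only [h]
  rw [integral_finsetSum _ fun a _ => (integrable_const (f a)).indicator (hX a)]
  refine sum_congr rfl fun a _ => ?_
  rw [integral_indicator_const _ (hX a), smul_eq_mul]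

namespace PAComplex

variable {k : ℕ} {δ : ℝ} {Ω : Type*} [MeasurableSpace Ω] (M : PAComplex k δ Ω)

theorem reachable (n : ℕ) (ω : Ω) : Reachable k n (M.G n ω) := by
  induction n with
  | zero => exact M.init ω ▸ Reachable.init
  | succ n ih =>
    rw [M.step (n + 1) ω (by omega)]
    exact Reachable.step n _ _ ih (M.choice_mem (n + 1) ω (by omega))

theorem measurableSet_G_eq (n : ℕ) (g : Finset (Finset ℕ)) :
    MeasurableSet {ω | M.G n ω = g} :=
  M.meas_G n (MeasurableSpace.measurableSet_top (s := {g}))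

theorem measurableSet_choice_eq (n : ℕ) (s : Finset ℕ) :
    MeasurableSet {ω | M.choice n ω = s} :=
  M.meas_choice n (MeasurableSpace.measurableSet_top (s := {s}))

theorem measure_choice_and_G (n : ℕ) {g : Finset (Finset ℕ)} {s : Finset ℕ}
    (hs : s ∈ kSimplices k g) :
    M.μ {ω | M.choice (n + 1) ω = s ∧ M.G n ω = g}
      = ENNReal.ofReal (((simDeg k g s : ℝ) + δ) / ∑ t ∈ kSimplices k g, ((simDeg k g t : ℝ) + δ))
        * M.μ {ω | M.G n ω = g} := by
  let ext (h : Fin n → Finset (Finset ℕ)) : ℕ → Finset (Finset ℕ) :=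
    fun j => if hj : j < n then h ⟨j, hj⟩ else g
  have hextn : ∀ h, ext h n = g := fun h => by simp [ext]
  have hmeas : ∀ h, MeasurableSet {ω | ∀ j < n + 1, M.G j ω = ext h j} := by
    intro h
    have : {ω | ∀ j < n + 1, M.G j ω = ext h j}
        = ⋂ j, ⋂ (_ : j < n + 1), {ω | M.G j ω = ext h j} := by
      ext ω
      simp
    rw [this]
    exact MeasurableSet.iInter fun j => MeasurableSet.iInter fun _ => M.measurableSet_G_eq j _
  have hdisj : Pairwise fun h h' => Disjoint {ω | ∀ j < n + 1, M.G j ω = ext h j}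
      {ω | ∀ j < n + 1, M.G j ω = ext h' j} := by
    intro h h' hne
    rw [Set.disjoint_left]
    intro ω hω hω'
    refine hne (funext fun j => ?_)
    have h1 := (hω j (by omega)).symm.trans (hω' j (by omega))
    simpa [ext] using h1
  have hG : {ω | M.G n ω = g} = ⋃ h, {ω | ∀ j < n + 1, M.G j ω = ext h j} := by
    ext ω
    simp only [Set.mem_ofPred_eq, Set.mem_iUnion]
    constructor
    · intro hω
      refine ⟨fun j => M.G j ω, fun j hj => ?_⟩
      by_cases hjn : j < n
      · simp [ext, hjn]
      · have : j = n := by omega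
        rw [this]
        simp only [ext, lt_irrefl, dite_false]
        exact hω
    · rintro ⟨h, hω⟩
      rw [hω n (by omega), hextn]
  have hC : {ω | M.choice (n + 1) ω = s ∧ M.G n ω = g}
      = ⋃ h, {ω | M.choice (n + 1) ω = s ∧ ∀ j < n + 1, M.G j ω = ext h j} := by
    have : {ω | M.choice (n + 1) ω = s ∧ M.G n ω = g}
        = {ω | M.choice (n + 1) ω = s} ∩ {ω | M.G n ω = g} := rfl
    rw [this, hG, Set.inter_iUnion]
    rfl
  have hdisjC : Pairwise fun h h' =>
      Disjoint {ω | M.choice (n + 1) ω = s ∧ ∀ j < n + 1, M.G j ω = ext h j}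
        {ω | M.choice (n + 1) ω = s ∧ ∀ j < n + 1, M.G j ω = ext h' j} :=
    fun h h' hne => (hdisj hne).mono (fun _ hω => hω.2) (fun _ hω => hω.2)
  rw [hC, hG, measure_iUnion hdisj hmeas, measure_iUnion hdisjC
    (fun h => (M.measurableSet_choice_eq (n + 1) s).inter (hmeas h)), ← ENNReal.tsum_mul_left]
  refine tsum_congr fun h => ?_
  have := M.cond_law (n + 1) (by omega) (ext h) s (by simpa [hextn] using hs)
  simpa only [Nat.add_sub_cancel, hextn] using this

theorem measureReal_choice_and_G (hδ : -1 < δ) (n : ℕ) {g : Finset (Finset ℕ)} {s : Finset ℕ}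
    (hg : Reachable k n g) (hs : s ∈ kSimplices k g) :
    M.μ.real {ω | M.choice (n + 1) ω = s ∧ M.G n ω = g}
      = ((simDeg k g s : ℝ) + δ) / (tauc k δ * ((n : ℝ) + 1) + δ)
        * M.μ.real {ω | M.G n ω = g} := by
  have hpos : (1 : ℝ) ≤ simDeg k g s := by exact_mod_cast hg.simDeg_pos s hs
  rw [measureReal_def, M.measure_choice_and_G n hs, ENNReal.toReal_mul, hg.sum_weight,
    ENNReal.toReal_ofReal (div_nonneg (by linarith) (tauc_mul_add_pos hδ n).le), measureReal_def]

theorem integral_G_eq_sum (n : ℕ) (f : Finset (Finset ℕ) → ℝ) :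
    ∫ ω, f (M.G n ω) ∂M.μ
      = ∑ g ∈ (Finset.Icc 1 (n + k + 2)).powerset.powerset, M.μ.real {ω | M.G n ω = g} * f g := by
  have := M.isProb
  exact integral_comp_eq_sum M.μ _ _ (M.measurableSet_G_eq n) (fun ω => mem_powerset.2 fun t ht =>
    mem_powerset.2 ((M.reachable n ω).subset_Icc t ht)) f

theorem mExp_eq_sum (n : ℕ) (i : Fin (k + 1) → ℕ) :
    mExp M n i = ∑ g ∈ (Finset.Icc 1 (n + k + 2)).powerset.powerset,
      M.μ.real {ω | M.G n ω = g} * (Ncount k g i : ℝ) := by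
  rw [← M.integral_G_eq_sum n fun g => (Ncount k g i : ℝ), mExp]
  split_ifs with hi
  · rfl
  · simp [(M.reachable n _).Ncount_eq_zero hi]

/-- The law of total expectation for one step of the process. -/
theorem integral_Ncount_succ (hδ : -1 < δ) (n : ℕ) (i : Fin (k + 1) → ℕ) :
    ∫ ω, (Ncount k (M.G (n + 1) ω) i : ℝ) ∂M.μ
      = ∑ g ∈ (Finset.Icc 1 (n + k + 2)).powerset.powerset, M.μ.real {ω | M.G n ω = g}
        * ((∑ c ∈ kSimplices k g, ((simDeg k g c : ℝ) + δ)
          * (Ncount k (addSimplex g c (n + 1 + k + 2)) i : ℝ))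
            / (tauc k δ * ((n : ℝ) + 1) + δ)) := by
  have := M.isProb
  have hmem : ∀ ω, M.choice (n + 1) ω ∈ kSimplices k (M.G n ω) := fun ω =>
    M.choice_mem (n + 1) ω (by omega)
  have hstep : ∀ ω, (Ncount k (M.G (n + 1) ω) i : ℝ)
      = (fun x : Finset (Finset ℕ) × Finset ℕ =>
          (Ncount k (addSimplex x.1 x.2 (n + 1 + k + 2)) i : ℝ)) (M.G n ω, M.choice (n + 1) ω) :=
    fun ω => by rw [M.step (n + 1) ω (by omega), Nat.add_sub_cancel]
  have hsub : ∀ ω, ∀ t ∈ M.G n ω, t ⊆ Finset.Icc 1 (n + k + 2) := fun ω =>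
    (M.reachable n ω).subset_Icc
  have hset : ∀ x : Finset (Finset ℕ) × Finset ℕ,
      {ω | (M.G n ω, M.choice (n + 1) ω) = x}
        = {ω | M.choice (n + 1) ω = x.2 ∧ M.G n ω = x.1} := by
    intro x
    ext ω
    simp [Prod.ext_iff, and_comm]
  rw [integral_congr_ae (ae_of_all _ hstep),
    integral_comp_eq_sum M.μ (fun ω => (M.G n ω, M.choice (n + 1) ω))
    ((Finset.Icc 1 (n + k + 2)).powerset.powerset ×ˢ (Finset.Icc 1 (n + k + 2)).powerset)
    (fun x => by
      rw [hset]
      exact (M.measurableSet_choice_eq (n + 1) x.2).inter (M.measurableSet_G_eq n x.1))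
    (fun ω => mem_product.2 ⟨mem_powerset.2 fun t ht => mem_powerset.2 (hsub ω t ht),
      mem_powerset.2 (hsub ω _ (mem_kSimplices.1 (hmem ω)).1)⟩)
    (fun x => (Ncount k (addSimplex x.1 x.2 (n + 1 + k + 2)) i : ℝ)), sum_product]
  refine sum_congr rfl fun g _ => ?_
  simp only [hset]
  by_cases hg : ∃ ω, M.G n ω = g
  · obtain ⟨ω, rfl⟩ := hg
    rw [sum_div, mul_sum]
    refine (sum_subset_zero_on_sdiff (fun t ht => mem_powerset.2
      (hsub ω t (mem_kSimplices.1 ht).1)) (fun s hs => ?_) fun s hs => ?_).symm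
    · have : {ω' | M.choice (n + 1) ω' = s ∧ M.G n ω' = M.G n ω} = ∅ := by
        rw [Set.eq_empty_iff_forall_notMem]
        rintro ω' ⟨rfl, h⟩
        exact (Finset.mem_sdiff.1 hs).2 (h ▸ hmem ω')
      rw [this]
      simp
    · rw [M.measureReal_choice_and_G hδ n (M.reachable n ω) hs]
      ring
  · have h1 : {ω | M.G n ω = g} = ∅ := by
      rw [Set.eq_empty_iff_forall_notMem]
      exact fun ω h => hg ⟨ω, h⟩
    have h2 : ∀ s, {ω | M.choice (n + 1) ω = s ∧ M.G n ω = g} = ∅ := by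
      intro s
      rw [Set.eq_empty_iff_forall_notMem]
      exact fun ω h => hg ⟨ω, h.2⟩
    simp [h1, h2]

end PAComplex

/-- The recursion for the expected degree counts `m_n(i_0,…,i_k) = E[N_n(i_0,…,i_k)]`
(display (4.2) of the paper). -/
theorem expected_degree_counts_recursion (k : ℕ) (δ : ℝ) (hδ : -1 < δ)
    (Ω : Type*) [MeasurableSpace Ω] (M : PAComplex k δ Ω) :
    ∀ n : ℕ, 1 ≤ n → ∀ i : Fin (k + 1) → ℕ, ValidIdx k i →
      (∫ ω, (Ncount k (M.G n ω) i : ℝ) ∂M.μ)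
        = (1 - (((i 0 : ℝ) - k) * bcoef k δ 0 + δ) / (tauc k δ * n + δ)) * mExp M (n - 1) i
          + ((i (Fin.last k) : ℝ) - 1 + δ) / (tauc k δ * n + δ) * mExp M (n - 1) (allDec k i)
          + (∑ m : Fin k,
              (((i m.castSucc : ℝ) - k + (m : ℕ) - 1) * bcoef k δ (m : ℕ)
                - ((i m.succ : ℝ) - k + (m : ℕ) + 1) * bcoef k δ ((m : ℕ) + 1))
                / (tauc k δ * n + δ) * mExp M (n - 1) (decUpTo k (m : ℕ) i))
          + ((k : ℝ) + 1) *
              (if ∀ ℓ : Fin (k + 1), i ℓ = k - (ℓ : ℕ) + 1 then (1 : ℝ) else 0) := by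
  intro n hn i hi
  obtain ⟨n, rfl⟩ := Nat.exists_eq_add_of_le' hn
  have hprob := M.isProb
  have hZ := (tauc_mul_add_pos (k := k) hδ n).ne'
  have hconst : ∀ x : ℝ, x = ∑ g ∈ (Finset.Icc 1 (n + k + 2)).powerset.powerset,
      M.μ.real {ω | M.G n ω = g} * x := by
    intro x
    rw [← M.integral_G_eq_sum n fun _ => x]
    simp
  rw [M.integral_Ncount_succ hδ n i, Nat.add_sub_cancel, Nat.cast_add, Nat.cast_one]
  simp only [M.mExp_eq_sum, mul_sum]
  rw [sum_comm, hconst (((k : ℝ) + 1) * _), ← sum_add_distrib,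
    ← sum_add_distrib, ← sum_add_distrib]
  refine sum_congr rfl fun g _ => ?_
  by_cases hg : ∃ ω, M.G n ω = g
  · obtain ⟨ω, rfl⟩ := hg
    rw [(M.reachable n ω).sum_weight_mul_Ncount δ hi, add_div, add_div, add_div,
      mul_div_cancel_left₀ _ hZ, sum_div, mul_add, mul_add, mul_add, mul_sum]
    congr 1
    · congr 1
      · congr 1
        · rw [sub_mul, sub_div, mul_div_cancel_left₀ _ hZ]
          ring
        · ring
      · exact sum_congr rfl fun m _ => by ring
  · have h1 : {ω | M.G n ω = g} = ∅ := by
      rw [Set.eq_empty_iff_forall_notMem]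
      exact fun ω h => hg ⟨ω, h⟩
    simp [h1]
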